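/- Every zero-sum-free sequence α of length n over an abelian group with |Σ(α)| < 2n can be rearranged so that the resulting sequence is either connected or sharp. -/

import Mathlib

/-- The set of all subsequence sums of a list (including the sum 0 of the empty
subsequence). -/
def subSums {G : Type*} [AddCommMonoid G] [DecidableEq G] (l : List G) : Finset G :=
  (l.sublists.map List.sum).toFinset

/-- A sequence is zero-sum-free if no nonempty subsequence sums to zero. -/
def ZeroSumFree {G : Type*} [AddCommMonoid G] (l : List G) : Prop :=
  ∀ t : List G, t.Sublist l → t ≠ [] → t.sum ≠ 0

/-- A sequence `α` of length `n` is sharp if `Σ(α) = Σ(α_{n-1}) ∪ {σ(α)}`. -/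
def IsSharp {G : Type*} [AddCommMonoid G] [DecidableEq G] (l : List G) : Prop :=
  subSums l = subSums l.dropLast ∪ {l.sum}

/-- A sequence is connected if each term (after the first) is a difference of two
subsequence sums of the preceding terms: `a_k ∈ Σ(α_{k-1}) - Σ(α_{k-1})` for `k ∈ [2,n]`. -/
def IsConnectedSeq {G : Type*} [AddCommGroup G] [DecidableEq G] (l : List G) : Prop :=
  ∀ i : ℕ, ∀ h : i < l.length, 0 < i →
    ∃ x ∈ subSums (l.take i), ∃ y ∈ subSums (l.take i), l.get ⟨i, h⟩ = x - y

section SubsequenceSums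

variable {G : Type*}

theorem mem_subSums [AddCommMonoid G] [DecidableEq G] {l : List G} {x : G} :
    x ∈ subSums l ↔ ∃ t : List G, t.Subperm l ∧ t.sum = x := by
  simp only [subSums, List.mem_toFinset, List.mem_map, List.mem_sublists]
  constructor
  · rintro ⟨t, ht, rfl⟩
    exact ⟨t, ht.subperm, rfl⟩
  · rintro ⟨t, ⟨u, hut, hul⟩, rfl⟩
    exact ⟨u, hul, hut.sum_eq⟩

theorem List.Perm.subSums_eq [AddCommMonoid G] [DecidableEq G] {l l' : List G}
    (h : l.Perm l') : subSums l = subSums l' := by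
  ext x
  simp only [mem_subSums, h.subperm_left]

theorem zero_mem_subSums [AddCommMonoid G] [DecidableEq G] (l : List G) : 0 ∈ subSums l :=
  mem_subSums.2 ⟨[], List.nil_subperm, rfl⟩

theorem sum_mem_subSums [AddCommMonoid G] [DecidableEq G] (l : List G) : l.sum ∈ subSums l :=
  mem_subSums.2 ⟨l, List.Subperm.refl l, rfl⟩

theorem mem_subSums_of_mem [AddCommMonoid G] [DecidableEq G] {l : List G} {x : G}
    (h : x ∈ l) : x ∈ subSums l :=
  mem_subSums.2 ⟨[x], List.singleton_subperm_iff.2 h, by simp⟩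

theorem subSums_cons [AddCommMonoid G] [DecidableEq G] (a : G) (l : List G) :
    subSums (a :: l) = subSums l ∪ (subSums l).image (a + ·) := by
  ext x
  simp only [subSums, List.mem_toFinset, List.mem_map, List.mem_sublists, Finset.mem_union,
    Finset.mem_image]
  constructor
  · rintro ⟨t, ht, rfl⟩
    rcases List.sublist_cons_iff.1 ht with h | ⟨r, rfl, h⟩
    · exact Or.inl ⟨t, h, rfl⟩
    · exact Or.inr ⟨r.sum, ⟨r, h, rfl⟩, by simp⟩
  · rintro (⟨t, ht, rfl⟩ | ⟨_, ⟨t, ht, rfl⟩, rfl⟩)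
    · exact ⟨t, ht.cons a, rfl⟩
    · exact ⟨a :: t, ht.cons_cons a, by simp⟩

theorem ZeroSumFree.perm [AddCommMonoid G] {l l' : List G} (hl : ZeroSumFree l)
    (h : l.Perm l') : ZeroSumFree l' := by
  intro t ht hne
  obtain ⟨u, hut, hul⟩ := h.subperm_left.2 ht.subperm
  rw [← hut.sum_eq]
  refine hl u hul ?_
  rintro rfl
  exact hne hut.nil_eq.symm

theorem ZeroSumFree.of_cons [AddCommMonoid G] {a : G} {l : List G}
    (h : ZeroSumFree (a :: l)) : ZeroSumFree l :=
  fun t ht => h t (ht.cons a)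

variable [AddCommGroup G] [DecidableEq G]

theorem sum_sub_mem_subSums {l : List G} {x : G} (h : x ∈ subSums l) :
    l.sum - x ∈ subSums l := by
  obtain ⟨_, ⟨t, htp, ht⟩, rfl⟩ := mem_subSums.1 h
  obtain ⟨u, hu⟩ := ht.exists_perm_append
  refine mem_subSums.2 ⟨u, ?_, ?_⟩
  · exact hu.subperm_left.2 (List.sublist_append_right t u).subperm
  · rw [hu.sum_eq, List.sum_append, htp.sum_eq]
    abel

theorem ZeroSumFree.neg_notMem {a : G} {l : List G} (h : ZeroSumFree (a :: l)) :
    -a ∉ subSums l := by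
  intro hm
  obtain ⟨t, ⟨u, hut, hul⟩, hs⟩ := mem_subSums.1 hm
  refine h (a :: u) (hul.cons_cons a) (by simp) ?_
  rw [List.sum_cons, hut.sum_eq, hs, add_neg_cancel]

theorem ZeroSumFree.sum_cons_notMem {a : G} {l : List G} (h : ZeroSumFree (a :: l)) :
    (a :: l).sum ∉ subSums l := by
  intro hm
  apply h.neg_notMem
  have := sum_sub_mem_subSums hm
  rwa [List.sum_cons, sub_add_cancel_right] at this

theorem insert_sum_subset_subSums_cons {a : G} {l : List G} :
    insert (a :: l).sum (subSums l) ⊆ subSums (a :: l) := by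
  rw [Finset.insert_subset_iff]
  refine ⟨sum_mem_subSums _, ?_⟩
  rw [subSums_cons]
  exact Finset.subset_union_left

theorem ZeroSumFree.card_subSums_add_one_le {a : G} {l : List G} (h : ZeroSumFree (a :: l)) :
    (subSums l).card + 1 ≤ (subSums (a :: l)).card := by
  rw [← Finset.card_insert_of_notMem h.sum_cons_notMem]
  exact Finset.card_le_card insert_sum_subset_subSums_cons

theorem ZeroSumFree.length_add_one_le_card_subSums {l : List G} (h : ZeroSumFree l) :
    l.length + 1 ≤ (subSums l).card := by
  induction l with
  | nil => exact Finset.card_pos.2 ⟨0, zero_mem_subSums _⟩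
  | cons a l ih =>
    have := ih h.of_cons
    have := h.card_subSums_add_one_le
    simp only [List.length_cons]
    omega

/-- If adjoining `a` creates a single new sum, that sum is the total sum. -/
theorem ZeroSumFree.mem_subSums_of_card_le {a x : G} {l : List G} (h : ZeroSumFree (a :: l))
    (hc : (subSums (a :: l)).card ≤ (subSums l).card + 1) (hx : x ∈ subSums (a :: l))
    (hne : x ≠ (a :: l).sum) : x ∈ subSums l := by
  rw [← Finset.card_insert_of_notMem h.sum_cons_notMem] at hc
  rw [← Finset.eq_of_subset_of_card_le insert_sum_subset_subSums_cons hc] at hx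
  exact (Finset.mem_insert.1 hx).resolve_left hne

/-- If adjoining `a` creates a single new sum, every nonzero sum can be written using `a`. -/
theorem ZeroSumFree.sub_mem_subSums_of_card_le {a x : G} {l : List G}
    (h : ZeroSumFree (a :: l)) (hc : (subSums (a :: l)).card ≤ (subSums l).card + 1)
    (hx : x ∈ subSums (a :: l)) (hne : x ≠ 0) : x - a ∈ subSums l := by
  have hs := h.mem_subSums_of_card_le hc (sum_sub_mem_subSums hx) (by simpa using hne)
  have := sum_sub_mem_subSums hs
  rw [List.sum_cons] at this
  convert this using 1
  abel

/-- If removing `x` and removing `y` each destroy a single sum, then `x = y`. -/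
theorem ZeroSumFree.eq_of_card_le {x y : G} {l m : List G} (h : ZeroSumFree (x :: l))
    (hp : (x :: l).Perm (y :: m)) (hx : (subSums (x :: l)).card ≤ (subSums l).card + 1)
    (hy : (subSums (y :: m)).card ≤ (subSums m).card + 1) : x = y := by
  have h' := h.perm hp
  have hsub : ∀ {a z : G} {k : List G}, z ∈ subSums k → z ∈ subSums (a :: k) := fun hz => by
    rw [subSums_cons]
    exact Finset.mem_union_left _ hz
  by_contra hne
  have hx0 : x ≠ 0 := by
    have := h [x] (by simp) (by simp)
    simpa using this
  have h1 : x - y ∈ subSums m := h'.sub_mem_subSums_of_card_le hy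
    (hp.subSums_eq ▸ mem_subSums_of_mem (by simp)) hx0
  have h2 : x - y - x ∈ subSums l := h.sub_mem_subSums_of_card_le hx
    (hp.subSums_eq ▸ hsub h1) (sub_ne_zero.2 hne)
  rw [sub_sub_cancel_left] at h2
  refine h'.neg_notMem (h'.mem_subSums_of_card_le hy (hp.subSums_eq ▸ hsub h2) ?_)
  rw [← hp.sum_eq]
  intro he
  exact h.sum_cons_notMem (he ▸ h2)

theorem IsConnectedSeq.concat {l : List G} {b : G} (hl : IsConnectedSeq l)
    (hb : ∃ x ∈ subSums l, ∃ y ∈ subSums l, b = x - y) : IsConnectedSeq (l ++ [b]) := by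
  intro i h hi
  rcases lt_or_ge i l.length with hlt | hge
  · have := hl i hlt hi
    rw [List.take_append_of_le_length hlt.le]
    simpa [List.getElem_append_left hlt] using this
  · have : i = l.length := by
      simp only [List.length_append, List.length_singleton] at h
      omega
    subst this
    simpa using hb

theorem isConnectedSeq_of_forall_eq {l : List G} {a : G} (h : ∀ x ∈ l, x = a) :
    IsConnectedSeq l := by
  intro i hi hpos
  refine ⟨a, ?_, 0, zero_mem_subSums _, ?_⟩
  · apply mem_subSums_of_mem
    have hlt : 0 < (l.take i).length := by
      rw [List.length_take]
      omega
    have hm := List.getElem_mem hlt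
    rwa [h _ (List.mem_of_mem_take hm)] at hm
  · rw [sub_zero]
    exact h _ (List.get_mem l _)

theorem card_subSums_cons_of_forall_ne_sub {b : G} {l : List G}
    (h : ¬ ∃ x ∈ subSums l, ∃ y ∈ subSums l, b = x - y) :
    (subSums (b :: l)).card = 2 * (subSums l).card := by
  rw [subSums_cons, Finset.card_union_of_disjoint, Finset.card_image_of_injective, two_mul]
  · exact add_right_injective b
  · rw [Finset.disjoint_left]
    rintro x hx hx'
    obtain ⟨y, hy, rfl⟩ := Finset.mem_image.1 hx'
    exact h ⟨_, hx, y, hy, by simp⟩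

theorem ZeroSumFree.exists_perm_isConnectedSeq {l : List G} (hl : ZeroSumFree l)
    (hcard : (subSums l).card < 2 * l.length) :
    ∃ l' : List G, l.Perm l' ∧ IsConnectedSeq l' := by
  by_cases hb : ∃ b m, l.Perm (b :: m) ∧ (subSums m).card + 2 ≤ (subSums l).card
  · obtain ⟨b, m, hp, hc⟩ := hb
    have hlen : l.length = m.length + 1 := by simpa using hp.length_eq
    have hm : ZeroSumFree m := (hl.perm hp).of_cons
    obtain ⟨m', hp', hconn⟩ := hm.exists_perm_isConnectedSeq (by omega)
    refine ⟨m' ++ [b], (hp.trans (hp'.cons b)).trans (List.perm_append_singleton b m').symm,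
      hconn.concat ?_⟩
    by_contra hne
    rw [← hp'.subSums_eq] at hne
    have h1 := card_subSums_cons_of_forall_ne_sub hne
    have h2 := hm.length_add_one_le_card_subSums
    rw [← hp.subSums_eq] at h1
    omega
  · push Not at hb
    refine ⟨l, List.Perm.refl l, ?_⟩
    cases l with
    | nil => exact isConnectedSeq_of_forall_eq (a := 0) (by simp)
    | cons x m =>
      refine isConnectedSeq_of_forall_eq (a := x) fun y hy => ?_
      have hp := List.perm_cons_erase hy
      have h1 := hb x m (List.Perm.refl _)
      have h2 := hb y _ hp
      rw [hp.subSums_eq] at h2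
      exact (hl.eq_of_card_le hp (by omega) (by omega)).symm
termination_by l.length

end SubsequenceSums

/-- **Claim.** Every zero-sum-free sequence `α` of length `n` with `|Σ(α)| < 2n` can be
rearranged so that the resulting sequence is either connected or sharp. -/
theorem connected_or_sharp_rearrangement {G : Type*} [AddCommGroup G] [DecidableEq G]
    (l : List G) (hzsf : ZeroSumFree l) (hcard : (subSums l).card < 2 * l.length) :
    ∃ l' : List G, l.Perm l' ∧ (IsConnectedSeq l' ∨ IsSharp l') := by
  obtain ⟨l', hp, hconn⟩ := hzsf.exists_perm_isConnectedSeq hcard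
  exact ⟨l', hp, Or.inl hconn⟩
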